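/- arXiv:1506.07626 — 2 statements merged into one kernel-verified Lean document; each statement's English description precedes it below -/
import Mathlib

section
/- Local representation formula for the specific volume (integral-equation form): Let μ, R > 0 and τ > 0. Let θ : [0,τ] → [0,∞) and D : [0,τ] → (0,∞) be continuous, and suppose v : [0,τ] → (0,∞) is continuous and satisfies, for every t ∈ [0,τ], (1/v(t)) · exp( (R/μ) ∫₀ᵗ θ(s)/v(s) ds ) = 1/D(t). Then for every t ∈ [0,τ]: v(t) = D(t) + (R/μ) ∫₀ᵗ (D(t)/D(s)) θ(s) ds. -/
open MeasureTheory intervalIntegral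

/-- The fundamental theorem of calculus for the exponential of a primitive. -/
theorem integral_exp_primitive_mul {g : ℝ → ℝ} {a b : ℝ} (hab : a ≤ b)
    (hg : ContinuousOn g (Set.Icc a b)) :
    ∫ s in a..b, Real.exp (∫ r in a..s, g r) * g s = Real.exp (∫ r in a..b, g r) - 1 := by
  have hG : ContinuousOn (fun s => Real.exp (∫ r in a..s, g r)) (Set.Icc a b) := by
    have h := continuousOn_primitive_interval (μ := volume) (f := g) (a := a) (b := b)
      (by rw [Set.uIcc_of_le hab]; exact hg.integrableOn_Icc)
    rw [Set.uIcc_of_le hab] at h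
    exact h.rexp
  refine (integral_eq_sub_of_hasDerivAt_of_le hab hG (fun x hx => ?_)
    ((hG.mul hg).intervalIntegrable_of_Icc hab)).trans ?_
  · have hgx : ContinuousOn g (Set.Icc a x) := hg.mono (Set.Icc_subset_Icc_right hx.2.le)
    exact (integral_hasDerivAt_right (hgx.intervalIntegrable_of_Icc hx.1.le)
      ((hg.mono Set.Ioo_subset_Icc_self).stronglyMeasurableAtFilter isOpen_Ioo x hx)
      (hg.continuousAt (Icc_mem_nhds hx.1 hx.2))).exp
  · simp

/-- Local representation formula for the specific volume (integral-equation form):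
if `v, D > 0` and `θ ≥ 0` are continuous on `[0,τ]` and
`(1/v(t)) exp((R/μ)∫₀ᵗ θ/v) = 1/D(t)` for all `t ∈ [0,τ]`, then
`v(t) = D(t) + (R/μ)∫₀ᵗ (D(t)/D(s)) θ(s) ds`. -/
theorem specific_volume_local_representation
    (μ R τ : ℝ) (hμ : 0 < μ) (hR : 0 < R) (hτ : 0 < τ)
    (θ D v : ℝ → ℝ)
    (hθc : ContinuousOn θ (Set.Icc 0 τ)) (hθ : ∀ t ∈ Set.Icc (0 : ℝ) τ, 0 ≤ θ t)
    (hDc : ContinuousOn D (Set.Icc 0 τ)) (hD : ∀ t ∈ Set.Icc (0 : ℝ) τ, 0 < D t)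
    (hvc : ContinuousOn v (Set.Icc 0 τ)) (hv : ∀ t ∈ Set.Icc (0 : ℝ) τ, 0 < v t)
    (hid : ∀ t ∈ Set.Icc (0 : ℝ) τ,
      (1 / v t) * Real.exp ((R / μ) * ∫ s in (0 : ℝ)..t, θ s / v s) = 1 / D t) :
    ∀ t ∈ Set.Icc (0 : ℝ) τ,
      v t = D t + (R / μ) * ∫ s in (0 : ℝ)..t, (D t / D s) * θ s := by
  intro t ht
  have hsub : Set.Icc 0 t ⊆ Set.Icc 0 τ := Set.Icc_subset_Icc_right ht.2
  have hexp : ∀ s ∈ Set.Icc (0 : ℝ) τ,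
      Real.exp (∫ r in (0 : ℝ)..s, R / μ * (θ r / v r)) = v s / D s := by
    intro s hs
    have h := hid s hs
    have hvs := (hv s hs).ne'
    rw [intervalIntegral.integral_const_mul, div_eq_mul_one_div (v s), ← h]
    field_simp
  have key := integral_exp_primitive_mul (g := fun s => R / μ * (θ s / v s)) ht.1
    ((continuousOn_const.mul (hθc.div hvc fun s hs => (hv s hs).ne')).mono hsub)
  have hcongr : ∫ s in (0 : ℝ)..t,
      Real.exp (∫ r in (0 : ℝ)..s, R / μ * (θ r / v r)) * (R / μ * (θ s / v s)) =
      ∫ s in (0 : ℝ)..t, R / μ * (θ s / D s) := by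
    refine integral_congr fun s hs => ?_
    rw [Set.uIcc_of_le ht.1] at hs
    have hvs := (hv s (hsub hs)).ne'
    simp only [hexp s (hsub hs)]
    field_simp
  rw [hcongr, hexp t ht, intervalIntegral.integral_const_mul] at key
  have hDt := (hD t ht).ne'
  have hpull : ∫ s in (0 : ℝ)..t, D t / D s * θ s = D t * ∫ s in (0 : ℝ)..t, θ s / D s := by
    rw [← intervalIntegral.integral_const_mul]
    congr 1 with s
    ring
  rw [hpull, mul_left_comm, key]
  field_simp
  ring
end

section
/- Local-in-time lower bound for the temperature via the maximum principle: Let κ, c_v, C₃ > 0, let 0 ≤ s ≤ T, and let θ, u, ρ be continuous functions on [s,T]×[0,∞) with θ of class C^{1,2} on (s,T]×(0,∞), θ > 0 and θ bounded, u bounded, and 0 < ρ̲ ≤ ρ(t,x) ≤ ρ̄ < ∞. Suppose θ satisfies the differential inequality θ_t + u θ_x - (κ/(c_v ρ)) θ_{xx} + C₃ θ² ≥ 0 on (s,T]×(0,∞). Let m := inf_{x≥0} θ(s,x) > 0 and set θ̲(t) := m/(C₃ m (t-s) + 1). If θ(t,0) ≥ θ̲(t) for all t ∈ [s,T] and liminf_{x→∞}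 inf_{t∈[s,T]} (θ(t,x) - θ̲(t)) ≥ 0, then θ(t,x) ≥ θ̲(t) = m/(C₃ m (t-s) + 1) for all t ∈ [s,T] and x ≥ 0. -/
open Set

/-- The second derivative is nonnegative at a local minimum. -/
theorem deriv_deriv_nonneg_of_isLocalMin {f : ℝ → ℝ} {x : ℝ} (hmin : IsLocalMin f x)
    (hf : ContinuousAt f x) : 0 ≤ deriv (deriv f) x := by
  by_contra! hneg
  have hmax := isLocalMax_of_deriv_deriv_neg hneg hmin.deriv_eq_zero hf
  have hconst : f =ᶠ[nhds x] fun _ => f x := by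
    filter_upwards [hmin, hmax] with y h₁ h₂ using le_antisymm h₂ h₁
  rw [hconst.deriv.deriv_eq] at hneg
  simp at hneg

/-- The derivative is nonpositive at a point where a minimum over an interval to the left is
attained. -/
theorem HasDerivAt.nonpos_of_forall_Icc_le {f : ℝ → ℝ} {f' a b : ℝ} (hf : HasDerivAt f f' b)
    (hab : a < b) (hmin : ∀ y ∈ Icc a b, f b ≤ f y) : f' ≤ 0 := by
  have hslope := (hasDerivWithinAt_iff_tendsto_slope' self_notMem_Iio).1
    (hf.hasDerivWithinAt (s := Iio b))
  refine le_of_tendsto hslope ?_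
  filter_upwards [Ioo_mem_nhdsLT hab] with y hy
  rw [slope_def_field]
  exact div_nonpos_of_nonneg_of_nonpos (sub_nonneg.2 (hmin y ⟨hy.1.le, hy.2.le⟩))
    (sub_nonpos.2 hy.2.le)

/-- The barrier `m / (c (t - s) + 1)`, `c = C m`, solves the Riccati equation `y' = -C y²`. -/
theorem hasDerivAt_riccati {C m s t : ℝ} (h : C * m * (t - s) + 1 ≠ 0) :
    HasDerivAt (fun τ => m / (C * m * (τ - s) + 1)) (-(C * (m / (C * m * (t - s) + 1)) ^ 2)) t := by
  have hd : HasDerivAt (fun τ => C * m * (τ - s) + 1) (C * m) t := by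
    simpa using (((hasDerivAt_id t).sub_const s).const_mul (C * m)).add_const 1
  refine ((hasDerivAt_const t m).fun_div hd h).congr_deriv ?_
  rw [div_pow]
  ring

/-- Local-in-time lower bound for the temperature via the maximum principle:
if `θ > 0` is bounded, satisfies `θ_t + uθ_x - (κ/(c_vρ))θ_{xx} + C₃θ² ≥ 0` on
`(s,T]×(0,∞)` with bounded `u` and `0 < ρ̲ ≤ ρ ≤ ρ̄`, if `m > 0` is a lower bound
for `θ(s,·)`, and if `θ` dominates the barrier `θ̲(t) = m/(C₃ m (t-s) + 1)` on the
lateral boundary `x = 0` and in the liminf sense as `x → ∞`, then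
`θ(t,x) ≥ m/(C₃ m (t-s) + 1)` on `[s,T]×[0,∞)`. -/
theorem temperature_local_lower_bound_maximum_principle
    (κ cv C₃ s T m ρlow ρhigh Mθ Mu : ℝ)
    (hκ : 0 < κ) (hcv : 0 < cv) (hC₃ : 0 < C₃) (hs : 0 ≤ s) (hsT : s ≤ T)
    (θ u ρ : ℝ → ℝ → ℝ)
    (hcont : ContinuousOn (fun p : ℝ × ℝ => (θ p.1 p.2, u p.1 p.2, ρ p.1 p.2))
      (Icc s T ×ˢ Ici 0))
    (hreg : ∀ t ∈ Ioc s T, ∀ x : ℝ, 0 < x →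
      DifferentiableAt ℝ (fun τ => θ τ x) t ∧ ContDiffAt ℝ 2 (fun y => θ t y) x)
    (hθpos : ∀ t ∈ Icc s T, ∀ x : ℝ, 0 ≤ x → 0 < θ t x ∧ θ t x ≤ Mθ)
    (hub : ∀ t ∈ Icc s T, ∀ x : ℝ, 0 ≤ x → |u t x| ≤ Mu)
    (hρlow : 0 < ρlow)
    (hρ : ∀ t ∈ Icc s T, ∀ x : ℝ, 0 ≤ x → ρlow ≤ ρ t x ∧ ρ t x ≤ ρhigh)
    (hineq : ∀ t ∈ Ioc s T, ∀ x : ℝ, 0 < x →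
      deriv (fun τ => θ τ x) t + u t x * deriv (fun y => θ t y) x
        - (κ / (cv * ρ t x)) * deriv (deriv (fun y => θ t y)) x
        + C₃ * (θ t x) ^ 2 ≥ 0)
    (hm : 0 < m) (hm0 : ∀ x : ℝ, 0 ≤ x → m ≤ θ s x)
    (hbdry : ∀ t ∈ Icc s T, θ t 0 ≥ m / (C₃ * m * (t - s) + 1))
    (hinfty : ∀ ε > (0 : ℝ), ∃ X : ℝ, ∀ x ≥ X, ∀ t ∈ Icc s T,
      θ t x - m / (C₃ * m * (t - s) + 1) ≥ -ε) :
    ∀ t ∈ Icc s T, ∀ x : ℝ, 0 ≤ x → θ t x ≥ m / (C₃ * m * (t - s) + 1) := by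
  intro t₀ ht₀ x₀ hx₀
  by_contra! hlt
  have hden : ∀ t ∈ Icc s T, 0 < C₃ * m * (t - s) + 1 := fun t ht => by
    have := sub_nonneg.2 ht.1
    positivity
  let Θ : ℝ × ℝ → ℝ := fun p => θ p.1 p.2 - m / (C₃ * m * (p.1 - s) + 1)
  have hΘ₀ : Θ (t₀, x₀) < 0 := sub_neg.2 hlt
  obtain ⟨X, hX⟩ := hinfty (-Θ (t₀, x₀) / 2) (by linarith)
  let R := max X x₀
  have hsub : Icc s T ×ˢ Icc 0 R ⊆ Icc s T ×ˢ Ici 0 := prod_mono_right fun x hx => hx.1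
  have hΘcont : ContinuousOn Θ (Icc s T ×ˢ Icc 0 R) :=
    (hcont.mono hsub).fst.sub
      (ContinuousOn.div (by fun_prop) (by fun_prop) fun p hp => (hden p.1 hp.1).ne')
  have hmem₀ : (t₀, x₀) ∈ Icc s T ×ˢ Icc 0 R := ⟨ht₀, hx₀, le_max_right _ _⟩
  obtain ⟨⟨t, x⟩, ⟨ht, hx⟩, hmin⟩ :=
    (isCompact_Icc.prod isCompact_Icc).exists_isMinOn ⟨_, hmem₀⟩ hΘcont
  dsimp only at ht hx
  have hle : Θ (t, x) ≤ Θ (t₀, x₀) := hmin hmem₀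
  have hΘdef : Θ (t, x) = θ t x - m / (C₃ * m * (t - s) + 1) := rfl
  have hts : s < t := by
    refine lt_of_le_of_ne ht.1 ?_
    rintro rfl
    have := hm0 x hx.1
    simp only [sub_self, mul_zero, zero_add, div_one] at hΘdef
    linarith
  have hx0 : 0 < x := by
    refine lt_of_le_of_ne hx.1 ?_
    rintro rfl
    have := hbdry t ht
    linarith
  have hxR : x < R := by
    refine lt_of_le_of_ne hx.2 fun h => ?_
    have := hX x (h ▸ le_max_left _ _) t ht
    linarith
  have htT : t ∈ Ioc s T := ⟨hts, ht.2⟩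
  obtain ⟨hdt, hdx⟩ := hreg t htT x hx0
  have htime : deriv (fun τ => θ τ x) t - -(C₃ * (m / (C₃ * m * (t - s) + 1)) ^ 2) ≤ 0 :=
    (hdt.hasDerivAt.sub (hasDerivAt_riccati (hden t ht).ne')).nonpos_of_forall_Icc_le hts
      fun τ hτ => hmin (show (τ, x) ∈ Icc s T ×ˢ Icc 0 R from ⟨⟨hτ.1, hτ.2.trans ht.2⟩, hx⟩)
  have hspace : IsLocalMin (fun y => θ t y) x := by
    filter_upwards [Ioo_mem_nhds hx0 hxR] with y hy
    have : Θ (t, x) ≤ Θ (t, y) := hmin ⟨ht, hy.1.le, hy.2.le⟩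
    exact (sub_le_sub_iff_right _).1 this
  have hdiff := deriv_deriv_nonneg_of_isLocalMin hspace hdx.continuousAt
  have hρpos : 0 < ρ t x := hρlow.trans_le (hρ t ht x hx.1).1
  have hdiffusion : 0 ≤ κ / (cv * ρ t x) * deriv (deriv fun y => θ t y) x := by positivity
  have hmain := hineq t htT x hx0
  rw [hspace.deriv_eq_zero, mul_zero] at hmain
  have hsq : θ t x ^ 2 < (m / (C₃ * m * (t - s) + 1)) ^ 2 :=
    pow_lt_pow_left₀ (by linarith) (hθpos t ht x hx.1).1.le two_ne_zero
  have := mul_lt_mul_of_pos_left hsq hC₃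
  linarith
end
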